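/- Let l, m be positive integers, φ: ℕ → (0,1) a non-increasing function, and M ∈ ℝ^{l×m} a φ-badly approximable matrix with rows α_1,…,α_l. For j ∈ ℤ^m set P_j := ({j·α_1},…,{j·α_l}) ∈ ℝ^l, and for k = (k_1,…,k_l) with each k_u a positive integer set R(k) := ∏_{u=1}^l [2^{−k_u}, 2^{−k_u+1}). Then for every positive integer J and every such k, #{j ∈ ℤ^m \ {0} : |j| ≤ J and P_j ∈ R(k)} ≤ 2^l (∏_{u=1}^l 2^{−k_u}) / φ(2J). -/

import Mathlib

/-- Distance to the nearest integer. -/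
noncomputable def dNI (y : ℝ) : ℝ := |y - round y|

/-- Supremum norm of an integer vector, as a natural number. -/
def jnorm {m : ℕ} (j : Fin m → ℤ) : ℕ := Finset.univ.sup fun i => (j i).natAbs

/-- A matrix `M ∈ ℝ^{l×m}` is `φ`-badly approximable if
`∏_u ‖j·row_u(M)‖ ≥ φ(|j|)` for all `j ∈ ℤ^m \ {0}`. -/
def PhiBad {l m : ℕ} (φ : ℕ → ℝ) (M : Matrix (Fin l) (Fin m) ℝ) : Prop :=
  ∀ j : Fin m → ℤ, j ≠ 0 → φ (jnorm j) ≤ ∏ u, dNI (∑ v, (j v : ℝ) * M u v)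

theorem dNI_le_abs_sub_intCast (y : ℝ) (n : ℤ) : dNI y ≤ |y - n| := round_le y n

theorem dNI_nonneg (y : ℝ) : 0 ≤ dNI y := abs_nonneg _

theorem dNI_le_fract (y : ℝ) : dNI y ≤ Int.fract y := by
  have h := dNI_le_abs_sub_intCast y ⌊y⌋
  rwa [Int.self_sub_floor, Int.abs_fract] at h

theorem dNI_sub_le (x y : ℝ) : dNI (x - y) ≤ |Int.fract x - Int.fract y| := by
  have h := dNI_le_abs_sub_intCast (x - y) (⌊x⌋ - ⌊y⌋)
  have e : x - y - ((⌊x⌋ - ⌊y⌋ : ℤ) : ℝ) = Int.fract x - Int.fract y := by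
    simp only [Int.fract]; push_cast; ring
  rwa [e] at h

theorem jnorm_sub_le {m : ℕ} (i j : Fin m → ℤ) : jnorm (i - j) ≤ jnorm i + jnorm j := by
  refine Finset.sup_le fun v _ => ?_
  have hi : (i v).natAbs ≤ jnorm i :=
    Finset.le_sup (f := fun v => (i v).natAbs) (Finset.mem_univ v)
  have hj : (j v).natAbs ≤ jnorm j :=
    Finset.le_sup (f := fun v => (j v).natAbs) (Finset.mem_univ v)
  rw [Pi.sub_apply]
  omega

/-- Among `T + 1` points of the half-open interval `[a, 2a)`, two are at distance less than
`a / T`. -/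
theorem exists_ne_abs_sub_mul_lt {ι : Type*} (f : ι → ℝ) {a : ℝ} (ha : 0 < a)
    (hf : ∀ i, f i ∈ Set.Ico a (2 * a)) {T : ℕ} (hT : Nat.card ι = T + 1) (hT0 : 0 < T) :
    ∃ i j, i ≠ j ∧ |f i - f j| * T < a := by
  have hfin : Finite ι := Nat.finite_of_card_ne_zero (by omega)
  have := Fintype.ofFinite ι
  have hT' : (0 : ℝ) < T := by exact_mod_cast hT0
  have hnn : ∀ i, 0 ≤ (f i - a) / a * T := fun i =>
    mul_nonneg (div_nonneg (sub_nonneg.2 (hf i).1) ha.le) hT'.le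
  have hlt : ∀ i, ⌊(f i - a) / a * T⌋₊ < T := fun i => by
    rw [Nat.floor_lt (hnn i)]
    have : (f i - a) / a < 1 := by
      rw [div_lt_one ha]; linarith [(hf i).2]
    nlinarith
  obtain ⟨i, j, hij, he⟩ := Fintype.exists_ne_map_eq_of_card_lt
    (fun i => (⟨⌊(f i - a) / a * T⌋₊, hlt i⟩ : Fin T))
    (by rw [Fintype.card_fin, ← Nat.card_eq_fintype_card]; omega)
  refine ⟨i, j, hij, ?_⟩
  have he' : ⌊(f i - a) / a * T⌋₊ = ⌊(f j - a) / a * T⌋₊ := congrArg Fin.val he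
  have h1 : |(f i - a) / a * T - (f j - a) / a * T| < 1 := by
    apply Int.abs_sub_lt_one_of_floor_eq_floor
    rw [← Int.natCast_floor_eq_floor (hnn i), ← Int.natCast_floor_eq_floor (hnn j), he']
  have e : (f i - a) / a * T - (f j - a) / a * T = (f i - f j) * T / a := by
    field_simp; ring
  rwa [e, abs_div, abs_mul, abs_of_pos hT', abs_of_pos ha, div_lt_one ha] at h1

/-- The counting estimate of §4 of the paper: the number of points
`P_j = ({j·α_1}, …, {j·α_l})` with `j ≠ 0`, `|j| ≤ J`, lying in the dyadic box
`R(k) = ∏_u [2^{-k_u}, 2^{-k_u+1})` is at most `2^l (∏_u 2^{-k_u}) / φ(2J)`. -/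
theorem count_points_in_dyadic_box
    (l m : ℕ) (hl : 0 < l) (hm : 0 < m)
    (φ : ℕ → ℝ) (hφ : ∀ q, 0 < φ q ∧ φ q < 1) (hmono : Antitone φ)
    (M : Matrix (Fin l) (Fin m) ℝ) (hM : PhiBad φ M)
    (J : ℕ) (hJ : 0 < J) (k : Fin l → ℕ) (hk : ∀ u, 1 ≤ k u) :
    (Nat.card {j : Fin m → ℤ | j ≠ 0 ∧ jnorm j ≤ J ∧
        ∀ u, Int.fract (∑ v, (j v : ℝ) * M u v)
          ∈ Set.Ico ((2 : ℝ) ^ (-(k u : ℤ))) ((2 : ℝ) ^ (-(k u : ℤ) + 1))} : ℝ)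
      ≤ 2 ^ l * (∏ u, (2 : ℝ) ^ (-(k u : ℤ))) / φ (2 * J) := by
  have hc : 0 < φ (2 * J) := (hφ _).1
  have ha : ∀ u, (0 : ℝ) < 2 ^ (-(k u : ℤ)) := fun u => by positivity
  have hpow : ∀ u, (2 : ℝ) ^ (-(k u : ℤ) + 1) = 2 * 2 ^ (-(k u : ℤ)) := fun u => by
    rw [zpow_add_one₀ two_ne_zero, mul_comm]
  simp only [hpow]
  set a : Fin l → ℝ := fun u => (2 : ℝ) ^ (-(k u : ℤ))
  set S : Set (Fin m → ℤ) := {j | j ≠ 0 ∧ jnorm j ≤ J ∧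
    ∀ u, Int.fract (∑ v, (j v : ℝ) * M u v) ∈ Set.Ico (a u) (2 * a u)}
  change (Nat.card S : ℝ) ≤ 2 ^ l * (∏ u, a u) / φ (2 * J)
  have hV : 0 < ∏ u, a u := Finset.prod_pos fun u _ => ha u
  rw [le_div_iff₀ hc]
  obtain h0 | h1 | ⟨T, hT0, hT⟩ : Nat.card S = 0 ∨ Nat.card S = 1 ∨
      ∃ T, 0 < T ∧ Nat.card S = T + 1 := by
    rcases Nat.lt_or_ge (Nat.card S) 2 with h | h
    · omega
    · exact Or.inr (Or.inr ⟨Nat.card S - 1, by omega, by omega⟩)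
  · rw [h0, Nat.cast_zero, zero_mul]
    positivity
  · have hne : Nonempty S := (Nat.card_pos_iff.1 (by omega)).1
    obtain ⟨j, hj0, hjJ, hj⟩ := hne
    rw [h1, Nat.cast_one, one_mul]
    calc φ (2 * J) ≤ φ (jnorm j) := hmono (by omega)
      _ ≤ ∏ u, dNI (∑ v, (j v : ℝ) * M u v) := hM j hj0
      _ ≤ ∏ u, 2 * a u := Finset.prod_le_prod (fun u _ => dNI_nonneg _)
          fun u _ => (dNI_le_fract _).trans (hj u).2.le
      _ = 2 ^ l * ∏ u, a u := by simp [Finset.prod_mul_distrib]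
  · let u₀ : Fin l := ⟨0, hl⟩
    obtain ⟨⟨i, hi0, hiJ, hi⟩, ⟨j, hj0, hjJ, hj⟩, hij, hclose⟩ := exists_ne_abs_sub_mul_lt
      (fun j : S => Int.fract (∑ v, (j.1 v : ℝ) * M u₀ v)) (ha u₀) (fun j => j.2.2.2 u₀) hT hT0
    have hsub : i - j ≠ 0 := sub_ne_zero.2 fun h => hij (Subtype.ext h)
    have hd : ∀ u, dNI (∑ v, ((i - j) v : ℝ) * M u v) ≤
        |Int.fract (∑ v, (i v : ℝ) * M u v) - Int.fract (∑ v, (j v : ℝ) * M u v)| := fun u => by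
      have e : ∑ v, ((i - j) v : ℝ) * M u v =
          ∑ v, (i v : ℝ) * M u v - ∑ v, (j v : ℝ) * M u v := by
        rw [← Finset.sum_sub_distrib]
        exact Finset.sum_congr rfl fun v _ => by rw [Pi.sub_apply]; push_cast; ring
      rw [e]
      exact dNI_sub_le _ _
    have hT' : (1 : ℝ) ≤ T := by exact_mod_cast hT0
    have hTc : T * φ (2 * J) ≤ ∏ u, a u := by
      calc T * φ (2 * J) ≤ T * ∏ u, dNI (∑ v, ((i - j) v : ℝ) * M u v) := by
            have hn := jnorm_sub_le i j
            gcongr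
            exact (hmono (by omega)).trans (hM _ hsub)
        _ = (dNI (∑ v, ((i - j) v : ℝ) * M u₀ v) * T) *
              ∏ u ∈ Finset.univ.erase u₀, dNI (∑ v, ((i - j) v : ℝ) * M u v) := by
            rw [← Finset.mul_prod_erase _ _ (Finset.mem_univ u₀)]; ring
        _ ≤ a u₀ * ∏ u ∈ Finset.univ.erase u₀, a u := by
            refine mul_le_mul ?_ ?_ (Finset.prod_nonneg fun u _ => dNI_nonneg _) (ha u₀).le
            · exact (mul_le_mul_of_nonneg_right (hd u₀) (by linarith)).trans hclose.le
            · refine Finset.prod_le_prod (fun u _ => dNI_nonneg _) fun u _ => (hd u).trans ?_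
              obtain ⟨hi1, hi2⟩ := hi u
              obtain ⟨hj1, hj2⟩ := hj u
              rw [abs_le]
              constructor <;> linarith
        _ = ∏ u, a u := Finset.mul_prod_erase _ _ (Finset.mem_univ u₀)
    have h2l : (2 : ℝ) ≤ 2 ^ l := le_self_pow₀ one_le_two hl.ne'
    rw [hT, Nat.cast_add, Nat.cast_one]
    nlinarith
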